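/- Let A be a real n×n matrix, B a real n×m matrix, C a real m×n matrix, and let η, c ∈ ℝ. Define the block matrices M = fromBlocks A B (−c•C) (c•1ₘ), P = fromBlocks 1ₙ 0 C 1ₘ, and Q = fromBlocks 1ₙ 0 (−C) 1ₘ, all of size (n+m)×(n+m). Then Q * P = 1 (so Q = P⁻¹), and the similarity transformation identity holds: Q * (1 − η • (P * M)) * P = 1 − η • fromBlocks (A + B*C) B 0 (c•1ₘ). -/

import Mathlib

open Matrix

/-- **Similarity transformation of the simplified Follow-the-Ridge Jacobian.**
With `M = fromBlocks A B (-c•C) (c•1)`, `P = fromBlocks 1 0 C 1` and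
`Q = fromBlocks 1 0 (-C) 1`, we have `Q * P = 1` (so `Q = P⁻¹`) and
`Q * (1 - η • (P * M)) * P = 1 - η • fromBlocks (A + B*C) B 0 (c•1)`. -/
theorem follow_the_ridge_similarity
    {n m : ℕ}
    (A : Matrix (Fin n) (Fin n) ℝ)
    (B : Matrix (Fin n) (Fin m) ℝ)
    (C : Matrix (Fin m) (Fin n) ℝ)
    (η c : ℝ) :
    let M : Matrix (Fin n ⊕ Fin m) (Fin n ⊕ Fin m) ℝ :=
      fromBlocks A B (-c • C) (c • (1 : Matrix (Fin m) (Fin m) ℝ))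
    let P : Matrix (Fin n ⊕ Fin m) (Fin n ⊕ Fin m) ℝ :=
      fromBlocks 1 0 C 1
    let Q : Matrix (Fin n ⊕ Fin m) (Fin n ⊕ Fin m) ℝ :=
      fromBlocks 1 0 (-C) 1
    Q * P = 1 ∧
      Q * (1 - η • (P * M)) * P =
        1 - η • fromBlocks (A + B * C) B 0 (c • (1 : Matrix (Fin m) (Fin m) ℝ)) := by
  intro M P Q
  have hQP : Q * P = 1 := by simp [Q, P, fromBlocks_multiply]
  have hMP : M * P = fromBlocks (A + B * C) B 0 (c • 1) := by
    simp [M, P, fromBlocks_multiply]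
  refine ⟨hQP, ?_⟩
  rw [Matrix.mul_sub, Matrix.sub_mul, Matrix.mul_one, hQP, Matrix.mul_smul, Matrix.smul_mul,
    ← Matrix.mul_assoc, hQP, Matrix.one_mul, hMP]
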